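/- Let U be an L-structure, A ⊆ U a set of parameters, and let M and N be elementary substructures of U each containing A. If M admits an enumeration that is a construction sequence over A (with respect to types computed in U) and N admits an enumeration that is a construction sequence over A (with respect to types computed in U), then there is an isomorphism of L-structures from M onto N fixing A pointwise. -/

import Mathlib

open FirstOrder FirstOrder.Language Set

universe u v w

/-- `b ≡_A b'`: the tuples `b` and `b'` satisfy the same first-order `L`-formulas with
parameters from `A` in `M`. -/
def SameType (L : FirstOrder.Language.{u, v}) {M : Type w} [L.Structure M] (A : Set M)
    {ι : Type*} (b b' : ι → M) : Prop :=
  ∀ (m : ℕ) (φ : L.Formula (ι ⊕ Fin m)) (p : Fin m → M), (∀ k, p k ∈ A) →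
    (φ.Realize (Sum.elim b p) ↔ φ.Realize (Sum.elim b' p))

/-- The formula `φ` with parameters `p` isolates the type of the tuple `b` over the
parameter set `P`. -/
def Isolates {L : FirstOrder.Language.{u, v}} {M : Type w} [L.Structure M] {ι : Type*} {m : ℕ}
    (φ : L.Formula (ι ⊕ Fin m)) (p : Fin m → M) (P : Set M) (b : ι → M) : Prop :=
  φ.Realize (Sum.elim b p) ∧ ∀ c : ι → M, φ.Realize (Sum.elim c p) → SameType L P c b

/-- The type `tp(b/P)` is isolated: some formula with parameters from `P` isolates it. -/
def IsolatedType (L : FirstOrder.Language.{u, v}) {M : Type w} [L.Structure M] (P : Set M)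
    {ι : Type*} (b : ι → M) : Prop :=
  ∃ (m : ℕ) (φ : L.Formula (ι ⊕ Fin m)) (p : Fin m → M),
    (∀ k, p k ∈ P) ∧ Isolates φ p P b

/-- `(b_i)` is a construction sequence over `A`: each `tp(b_i / A ∪ {b_j : j < i})` is
isolated. -/
def IsConstructionSequence (L : FirstOrder.Language.{u, v}) {M : Type w} [L.Structure M]
    (A : Set M) {ι : Type*} [LinearOrder ι] (b : ι → M) : Prop :=
  ∀ i : ι, IsolatedType L (A ∪ b '' {j | j < i}) ![b i]

/-- `B ⫛^wo_A C`: the tuples `B` and `C` are weakly orthogonal over `A`. -/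
def WeaklyOrthogonal (L : FirstOrder.Language.{u, v}) {M : Type w} [L.Structure M] (A : Set M)
    {ιB ιC : Type*} (B : ιB → M) (C : ιC → M) : Prop :=
  ∀ (B' : ιB → M) (C' : ιC → M), SameType L A B' B → SameType L A C' C →
    SameType L A (Sum.elim B' C') (Sum.elim B C)

/-- `f` is an elementary map on the subset `S` of `M`. -/
def IsElementaryMapOn (L : FirstOrder.Language.{u, v}) {M : Type w} [L.Structure M]
    (S : Set M) (f : M → M) : Prop :=
  ∀ (n : ℕ) (φ : L.Formula (Fin n)) (a : Fin n → M), (∀ k, a k ∈ S) →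
    (φ.Realize a ↔ φ.Realize (f ∘ a))

/-- `M` is strongly homogeneous: any two tuples with the same type over a set of parameters
are conjugate by an automorphism fixing those parameters pointwise. -/
def StronglyHomogeneous (L : FirstOrder.Language.{u, v}) (M : Type w) [L.Structure M] : Prop :=
  ∀ (P : Set M) (ι : Type w) (x y : ι → M), SameType L P x y →
    ∃ σ : M ≃[L] M, (∀ a ∈ P, σ a = a) ∧ ∀ i, σ (x i) = y i

/-- A binary relation is elementary when related finite tuples satisfy the same formulas. -/
def IsElementaryRel (L : FirstOrder.Language.{u, v}) {U : Type w} [L.Structure U]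
    (R : Set (U × U)) : Prop :=
  ∀ (α : Type) [Finite α] (φ : L.Formula α) (p : α → U × U), (∀ k, p k ∈ R) →
    (φ.Realize (Prod.fst ∘ p) ↔ φ.Realize (Prod.snd ∘ p))

/-- The identity relation on `P`. -/
def diagOn {U : Type w} (P : Set U) : Set (U × U) := image (fun x => (x, x)) P

/-- The relation pairing off the entries of two tuples. -/
def tupleRel {U : Type w} {α : Type} (x y : α → U) : Set (U × U) := range fun k => (x k, y k)

section ElementaryRel

variable {L : FirstOrder.Language.{u, v}} {U : Type w} [L.Structure U]

theorem fst_image_diagOn (P : Set U) : Prod.fst '' diagOn P = P := by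
  simp [diagOn, image_image]

theorem fst_image_tupleRel {α : Type} (x y : α → U) : Prod.fst '' tupleRel x y = range x := by
  simp only [tupleRel, ← range_comp]; rfl

theorem exists_factor_of_mem_union_range {X : Type*} {α β : Type} [Finite β] {R : Set X}
    {t : α → X} {p : β → X} (hp : ∀ k, p k ∈ R ∪ range t) :
    ∃ (n : ℕ) (g : β → α ⊕ Fin n) (r : Fin n → X), (∀ k, r k ∈ R) ∧ p = Sum.elim t r ∘ g := by
  classical
  obtain ⟨n, ⟨e⟩⟩ := Finite.exists_equiv_fin {k // p k ∈ R}
  have ht : ∀ k, p k ∉ R → ∃ j, t j = p k := fun k hk => (hp k).resolve_left hk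
  choose j hj using ht
  refine ⟨n, fun k => if h : p k ∈ R then .inr (e ⟨k, h⟩) else .inl (j k h),
    fun i => p (e.symm i), fun i => (e.symm i).2, ?_⟩
  ext1 k
  by_cases h : p k ∈ R <;> simp [h, hj]

theorem IsElementaryRel.mono {R S : Set (U × U)} (hS : IsElementaryRel L S) (h : R ⊆ S) :
    IsElementaryRel L R :=
  fun α _ φ p hp => hS α φ p fun k => h (hp k)

theorem IsElementaryRel.swap {R : Set (U × U)} (hR : IsElementaryRel L R) :
    IsElementaryRel L (Prod.swap ⁻¹' R) :=
  fun α _ φ p hp => (hR α φ (Prod.swap ∘ p) hp).symm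

theorem isElementaryRel_of_finite {R : Set (U × U)}
    (h : ∀ F ⊆ R, F.Finite → ∃ S, F ⊆ S ∧ IsElementaryRel L S) : IsElementaryRel L R := by
  intro α _ φ p hp
  obtain ⟨S, hFS, hS⟩ := h (range p) (range_subset_iff.2 hp) (finite_range p)
  exact hS α φ p fun k => hFS (mem_range_self k)

theorem isElementaryRel_sUnion {c : Set (Set (U × U))} (hne : c.Nonempty)
    (hc : DirectedOn (· ⊆ ·) c) (h : ∀ R ∈ c, IsElementaryRel L R) :
    IsElementaryRel L (⋃₀ c) :=
  isElementaryRel_of_finite fun _ hF hfin =>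
    let ⟨S, hSc, hFS⟩ := hc.exists_mem_subset_of_finite_of_subset_sUnion hne hfin hF
    ⟨S, hFS, h S hSc⟩

theorem isElementaryRel_diagOn (P : Set U) : IsElementaryRel L (diagOn P) := by
  intro α _ φ p hp
  have : Prod.fst ∘ p = Prod.snd ∘ p := by
    ext1 k
    obtain ⟨x, -, hx⟩ := hp k
    simp [← hx]
  rw [this]

theorem IsElementaryRel.eq_iff {R : Set (U × U)} (hR : IsElementaryRel L R) {x y x' y' : U}
    (h : (x, y) ∈ R) (h' : (x', y') ∈ R) : x = x' ↔ y = y' := by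
  have := hR (Fin 2) ((Term.var 0).equal (Term.var 1)) ![(x, y), (x', y')]
    (fun k => by fin_cases k <;> simpa)
  simpa using this

theorem sameType_iff_isElementaryRel {P : Set U} {α : Type} [Finite α] {x y : α → U} :
    SameType L P x y ↔ IsElementaryRel L (diagOn P ∪ tupleRel x y) := by
  constructor
  · intro h β _ φ p hp
    obtain ⟨n, g, r, hr, rfl⟩ := exists_factor_of_mem_union_range hp
    choose s hs hsr using hr
    obtain rfl : r = fun k => (s k, s k) := by ext1 k; exact (hsr k).symm
    have := h n (φ.relabel g) s hs
    rw [Formula.realize_relabel, Formula.realize_relabel] at this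
    convert this using 2 <;> · ext1 k; simp only [Function.comp]; cases g k <;> rfl
  · intro h m φ p hp
    have := h (α ⊕ Fin m) φ (Sum.elim (fun k => (x k, y k)) fun k => (p k, p k)) (by
      rintro (k | k)
      · exact .inr ⟨k, rfl⟩
      · exact .inl ⟨p k, hp k, rfl⟩)
    convert this using 2 <;> ext (k | k) <;> rfl

/-- An elementary relation extends along any tuple whose type over the domain is isolated. -/
theorem IsElementaryRel.union_tupleRel {R : Set (U × U)} (hR : IsElementaryRel L R) {α : Type}
    [Finite α] {m : ℕ} {φ : L.Formula (α ⊕ Fin m)} {q : Fin m → U × U} (hq : ∀ k, q k ∈ R)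
    {x y : α → U} (hx : Isolates φ (Prod.fst ∘ q) (Prod.fst '' R) x)
    (hy : φ.Realize (Sum.elim y (Prod.snd ∘ q))) : IsElementaryRel L (R ∪ tupleRel x y) := by
  intro β _ ψ p hp
  suffices key : ∀ ψ : L.Formula β, ψ.Realize (Prod.fst ∘ p) → ψ.Realize (Prod.snd ∘ p) from
    ⟨key ψ, fun h => by_contra fun h' => key ψ.not (by simpa using h') h⟩
  intro ψ hψ
  obtain ⟨n, g, r, hr, rfl⟩ := exists_factor_of_mem_union_range hp
  let χ : L.Formula (Fin m ⊕ Fin n) := Formula.iAlls α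
    ((φ.relabel (Sum.elim .inr (.inl ∘ .inl))).imp
      (ψ.relabel (Sum.elim .inr (.inl ∘ .inr) ∘ g)))
  have hχ : ∀ a : Fin m ⊕ Fin n → U, χ.Realize a ↔ ∀ z : α → U,
      φ.Realize (Sum.elim z (a ∘ .inl)) → ψ.Realize (Sum.elim z (a ∘ .inr) ∘ g) := by
    intro a
    simp only [χ, Formula.realize_iAlls, Formula.realize_imp, Formula.realize_relabel]
    refine forall_congr' fun z => ?_
    have h1 : (fun i => Sum.elim a z i) ∘ Sum.elim Sum.inr (Sum.inl ∘ Sum.inl) =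
        Sum.elim z (a ∘ .inl) := by ext (k | k) <;> rfl
    have h2 : (fun i => Sum.elim a z i) ∘ Sum.elim Sum.inr (Sum.inl ∘ Sum.inr) =
        Sum.elim z (a ∘ .inr) := by ext (k | k) <;> rfl
    rw [h1, ← Function.comp_assoc, h2]
  have h := hR _ χ (Sum.elim q r) (by rintro (k | k); exacts [hq k, hr k])
  rw [hχ, hχ] at h
  have hfst : Prod.fst ∘ Sum.elim (fun k => (x k, y k)) r ∘ g =
      Sum.elim x (Prod.fst ∘ r) ∘ g := by
    ext1 k; simp only [Function.comp]; cases g k <;> rfl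
  have hsnd : Prod.snd ∘ Sum.elim (fun k => (x k, y k)) r ∘ g =
      Sum.elim y (Prod.snd ∘ r) ∘ g := by
    ext1 k; simp only [Function.comp]; cases g k <;> rfl
  rw [hfst] at hψ
  rw [hsnd]
  refine h.1 (fun z hz => ?_) y hy
  have := hx.2 z hz n (ψ.relabel g) (Prod.fst ∘ r) fun k => mem_image_of_mem _ (hr k)
  rw [Formula.realize_relabel, Formula.realize_relabel] at this
  exact this.2 hψ

theorem SameType.symm {P : Set U} {α : Type*} {x y : α → U} (h : SameType L P x y) :
    SameType L P y x :=
  fun m φ p hp => (h m φ p hp).symm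

theorem SameType.mono {P Q : Set U} {α : Type*} {x y : α → U} (h : SameType L Q x y)
    (hPQ : P ⊆ Q) : SameType L P x y :=
  fun m φ p hp => h m φ p fun k => hPQ (hp k)

/-- Some formula with parameters from `E` isolates the type of `x` over `P`. -/
def IsolatedBy (L : FirstOrder.Language.{u, v}) {U : Type w} [L.Structure U] (E P : Set U)
    {α : Type} (x : α → U) : Prop :=
  ∃ (m : ℕ) (φ : L.Formula (α ⊕ Fin m)) (p : Fin m → U), (∀ k, p k ∈ E) ∧ Isolates φ p P x

theorem IsolatedBy.mono {E E' P P' : Set U} {α : Type} {x : α → U} (h : IsolatedBy L E P x)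
    (hE : E ⊆ E') (hP : P' ⊆ P) : IsolatedBy L E' P' x :=
  let ⟨m, φ, p, hp, hφ, hc⟩ := h
  ⟨m, φ, p, fun k => hE (hp k), hφ, fun c h => (hc c h).mono hP⟩

theorem IsolatedType.exists_finite {P : Set U} {α : Type} {x : α → U}
    (h : IsolatedType L P x) : ∃ E ⊆ P, E.Finite ∧ IsolatedBy L E P x :=
  let ⟨m, φ, p, hp, hφ⟩ := h
  ⟨range p, range_subset_iff.2 hp, finite_range p, m, φ, p, mem_range_self, hφ⟩

theorem isolatedType_of_isElementaryRel {P : Set U} {α γ : Type} [Finite α] [Finite γ]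
    {x : α → U} (φ : L.Formula (α ⊕ γ)) {p : γ → U} (hp : ∀ k, p k ∈ P)
    (hx : φ.Realize (Sum.elim x p))
    (hc : ∀ c, φ.Realize (Sum.elim c p) → IsElementaryRel L (diagOn P ∪ tupleRel x c)) :
    IsolatedType L P x := by
  obtain ⟨n, ⟨e⟩⟩ := Finite.exists_equiv_fin γ
  have h : ∀ c : α → U, (φ.relabel (Sum.map id e)).Realize (Sum.elim c (p ∘ e.symm)) ↔
      φ.Realize (Sum.elim c p) := by
    intro c
    rw [Formula.realize_relabel]
    convert Iff.rfl using 2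
    ext (k | k) <;> simp
  exact ⟨n, φ.relabel (Sum.map id e), p ∘ e.symm, fun k => hp _, (h x).2 hx,
    fun c hφc => (sameType_iff_isElementaryRel.2 (hc c ((h c).1 hφc))).symm⟩

theorem isolatedType_of_range_subset {P : Set U} {α : Type} [Finite α] {x : α → U}
    (hx : range x ⊆ P) : IsolatedType L P x := by
  let φ : L.Formula (α ⊕ α) :=
    Formula.iInf fun k => (Term.var (Sum.inl k)).equal (Term.var (Sum.inr k))
  have h : ∀ c, φ.Realize (Sum.elim c x) ↔ c = x := by
    intro c
    simp [φ, funext_iff]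
  refine isolatedType_of_isElementaryRel φ (range_subset_iff.1 hx) ((h x).2 rfl) fun c hc => ?_
  rw [h] at hc
  subst hc
  refine (isElementaryRel_diagOn P).mono (union_subset le_rfl ?_)
  rintro _ ⟨k, rfl⟩
  exact ⟨c k, hx (mem_range_self k), rfl⟩

theorem IsolatedType.sumElim {P : Set U} {α β : Type} [Finite α] [Finite β] {a : α → U}
    {x : β → U} (ha : IsolatedType L P a) (hx : IsolatedType L (P ∪ range a) x) :
    IsolatedType L P (Sum.elim a x) := by
  obtain ⟨m, φ, p, hp, hφ, hφc⟩ := ha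
  obtain ⟨n, ψ, q, hq, hψ⟩ := hx
  obtain ⟨l, g, s, hs, rfl⟩ := exists_factor_of_mem_union_range hq
  let χ : L.Formula ((α ⊕ β) ⊕ (Fin m ⊕ Fin l)) :=
    φ.relabel (Sum.map .inl .inl) ⊓
      ψ.relabel (Sum.elim (.inl ∘ .inr) (Sum.map .inl .inr ∘ g))
  have hχ : ∀ (c : α → U) (d : β → U), χ.Realize (Sum.elim (Sum.elim c d) (Sum.elim p s)) ↔
      φ.Realize (Sum.elim c p) ∧ ψ.Realize (Sum.elim d (Sum.elim c s ∘ g)) := by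
    intro c d
    simp only [χ, Formula.realize_inf, Formula.realize_relabel]
    refine and_congr (iff_of_eq (congrArg _ ?_)) (iff_of_eq (congrArg _ ?_))
    · ext (k | k) <;> rfl
    · ext (k | k)
      · rfl
      · simp only [Function.comp, Sum.elim_inr]
        cases g k <;> rfl
  refine isolatedType_of_isElementaryRel χ (p := Sum.elim p s)
    (by rintro (k | k); exacts [hp k, hs k]) ((hχ a x).2 ⟨hφ, hψ.1⟩) fun e he => ?_
  obtain ⟨c, d, rfl⟩ : ∃ c d, e = Sum.elim c d := ⟨_, _, (Sum.elim_comp_inl_inr e).symm⟩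
  rw [hχ] at he
  have hac := sameType_iff_isElementaryRel.1 (hφc c he.1).symm
  have hfst : Prod.fst ∘ Sum.elim (fun k => (a k, c k)) (fun k => (s k, s k)) ∘ g =
      Sum.elim a s ∘ g := by
    ext1 k; simp only [Function.comp]; cases g k <;> rfl
  have hsnd : Prod.snd ∘ Sum.elim (fun k => (a k, c k)) (fun k => (s k, s k)) ∘ g =
      Sum.elim c s ∘ g := by
    ext1 k; simp only [Function.comp]; cases g k <;> rfl
  refine (hac.union_tupleRel (φ := ψ)
    (q := Sum.elim (fun k => (a k, c k)) (fun k => (s k, s k)) ∘ g) (x := x) (y := d)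
    (fun k => ?_) ?_ ?_).mono ?_
  · simp only [Function.comp]
    cases g k with
    | inl j => exact .inr ⟨j, rfl⟩
    | inr j => exact .inl ⟨s j, hs j, rfl⟩
  · rw [hfst, image_union, fst_image_diagOn, fst_image_tupleRel]
    exact hψ
  · rw [hsnd]
    exact he.2
  · rintro z (hz | ⟨k | k, rfl⟩)
    · exact .inl (.inl hz)
    · exact .inl (.inr ⟨k, rfl⟩)
    · exact .inr ⟨k, rfl⟩

theorem IsolatedType.comp {P : Set U} {α β : Type} [Finite α] [Finite β] {a : α → U}
    (ha : IsolatedType L P a) (f : β → α) : IsolatedType L P (a ∘ f) := by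
  obtain ⟨m, φ, p, hp, hφ, hφc⟩ := ha
  let χ : L.Formula (β ⊕ Fin m) := Formula.iExs α
    (φ.relabel (Sum.elim .inr (.inl ∘ .inr)) ⊓
      Formula.iInf fun k => (Term.var (.inr (f k))).equal (Term.var (.inl (.inl k))))
  have hχ : ∀ c, χ.Realize (Sum.elim c p) ↔
      ∃ z : α → U, φ.Realize (Sum.elim z p) ∧ z ∘ f = c := by
    intro c
    simp only [χ, Formula.realize_iExs, Formula.realize_inf, Formula.realize_relabel]
    refine exists_congr fun z => and_congr (iff_of_eq (congrArg _ ?_)) ?_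
    · ext (k | k) <;> rfl
    · simp [funext_iff]
  refine isolatedType_of_isElementaryRel χ hp ((hχ _).2 ⟨a, hφ, rfl⟩) fun c hc => ?_
  obtain ⟨z, hz, rfl⟩ := (hχ c).1 hc
  refine (sameType_iff_isElementaryRel.1 (hφc z hz).symm).mono (union_subset_union_right _ ?_)
  rintro _ ⟨k, rfl⟩
  exact ⟨f k, rfl⟩

theorem IsolatedType.of_sumElim {P : Set U} {α β : Type} [Finite α] [Finite β] {a : α → U}
    {x : β → U} (h : IsolatedType L P (Sum.elim a x)) : IsolatedType L (P ∪ range a) x := by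
  obtain ⟨m, φ, p, hp, hφ, hφc⟩ := h
  have hχ : ∀ c : β → U, (φ.relabel (Sum.elim (Sum.elim (.inr ∘ .inl) .inl)
      (.inr ∘ .inr))).Realize (Sum.elim c (Sum.elim a p)) ↔
      φ.Realize (Sum.elim (Sum.elim a c) p) := by
    intro c
    rw [Formula.realize_relabel]
    convert Iff.rfl using 2
    ext ((k | k) | k) <;> rfl
  refine isolatedType_of_isElementaryRel _ (p := Sum.elim a p) ?_ ((hχ x).2 hφ)
    fun c hc => (sameType_iff_isElementaryRel.1 (hφc _ ((hχ c).1 hc)).symm).mono ?_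
  · rintro (k | k)
    exacts [.inr (mem_range_self k), .inl (hp k)]
  · rintro _ (⟨_, hz | ⟨k, rfl⟩, rfl⟩ | ⟨k, rfl⟩)
    · exact .inl ⟨_, hz, rfl⟩
    · exact .inr ⟨.inl k, rfl⟩
    · exact .inr ⟨.inr k, rfl⟩

/-- Induction on the finite subsets of `C ∪ M`, adding the elements of `M` in order of rank. -/
theorem finite_subset_induction {X ρ : Type*} [LinearOrder ρ] [WellFoundedLT ρ] {r : X → ρ}
    {C M : Set X} (hr : InjOn r M) {Q : Set X → Prop} (base : ∀ F ⊆ C, F.Finite → Q F)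
    (step : ∀ y ∈ M, (∀ F ⊆ C ∪ {z ∈ M | r z < r y}, F.Finite → Q F) →
      ∀ F ⊆ C ∪ {z ∈ M | r z < r y}, F.Finite → Q (insert y F)) :
    ∀ F ⊆ C ∪ M, F.Finite → Q F := by
  have reduce : ∀ F ⊆ C ∪ M, F.Finite →
      (∀ y ∈ F \ C, ∀ F' ⊆ C ∪ {z ∈ M | r z < r y}, F'.Finite → Q F') → Q F := by
    intro F hF hfin h
    rcases (F \ C).eq_empty_or_nonempty with hne | hne
    · exact base F (sdiff_eq_empty.1 hne) hfin
    · obtain ⟨y, hy, hmax⟩ := exists_max_image (F \ C) r hfin.sdiff hne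
      have hyM : y ∈ M := (hF hy.1).resolve_left hy.2
      rw [← insert_sdiff_self_of_mem hy.1]
      refine step y hyM (h y hy) _ (fun z hz => ?_) hfin.sdiff
      by_cases hzC : z ∈ C
      · exact .inl hzC
      · have hzM : z ∈ M := (hF hz.1).resolve_left hzC
        exact .inr ⟨hzM, (hmax z ⟨hz.1, hzC⟩).lt_of_ne fun h => hz.2 (hr hzM hyM h)⟩
  have below : ∀ y, ∀ F ⊆ C ∪ {z ∈ M | r z < r y}, F.Finite → Q F := by
    intro y
    induction y using (InvImage.wf r wellFounded_lt).induction with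
    | _ y ih =>
      intro F hF hfin
      refine reduce F (hF.trans (union_subset_union_right _ (sep_subset _ _))) hfin
        fun z hz => ih z ((hF hz.1).resolve_left hz.2).2
  exact fun F hF hfin => reduce F hF hfin fun y _ => below y

theorem IsConstructionSequence.exists_rank {A : Set U} {ι : Type*} [LinearOrder ι]
    [WellFoundedLT ι] {b : ι → U} (hb : IsConstructionSequence L A b) :
    ∃ r : U → WithTop ι, InjOn r (range b) ∧
      ∀ x ∈ range b, IsolatedType L (A ∪ {z ∈ range b | r z < r x}) ![x] := by
  classical
  have hmin : ∀ x ∈ range b, ∃ i, b i = x ∧ ∀ j, b j = x → i ≤ j := fun x hx =>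
    ⟨wellFounded_lt.min {i | b i = x} hx, wellFounded_lt.min_mem {i | b i = x} hx,
      fun j hj => wellFounded_lt.min_le (s := {i | b i = x}) hj⟩
  choose i hi hle using hmin
  let r : U → WithTop ι := fun x => if h : x ∈ range b then (i x h : WithTop ι) else ⊤
  have hr : ∀ x (h : x ∈ range b), r x = i x h := fun x h => dif_pos h
  refine ⟨r, fun x hx y hy h => ?_, fun x hx => ?_⟩
  · rw [hr x hx, hr y hy, WithTop.coe_inj] at h
    rw [← hi x hx, h, hi y hy]
  · have hset : {z ∈ range b | r z < r x} = b '' {j | j < i x hx} := by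
      ext z
      constructor
      · rintro ⟨hz, hlt⟩
        rw [hr z hz, hr x hx, WithTop.coe_lt_coe] at hlt
        exact ⟨i z hz, hlt, hi z hz⟩
      · rintro ⟨j, hj, rfl⟩
        refine ⟨mem_range_self j, ?_⟩
        rw [hr _ (mem_range_self j), hr x hx, WithTop.coe_lt_coe]
        exact (hle _ _ j rfl).trans_lt hj
    have := hb (i x hx)
    rwa [hi x hx, ← hset] at this

/-- Isolation over an initial segment survives adding a set closed under supports. -/
theorem isolatedBy_union_of_closed {ρ : Type*} [LinearOrder ρ] [WellFoundedLT ρ] {r : U → ρ}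
    {A M C : Set U} (hr : InjOn r M) {e : U → Set U} (hfin : ∀ x, (e x).Finite)
    (hsub : ∀ x ∈ M, e x ⊆ A ∪ {z ∈ M | r z < r x})
    (hiso : ∀ x ∈ M, IsolatedBy L (e x) (A ∪ {z ∈ M | r z < r x}) ![x])
    (hCM : C ⊆ M) (hcl : ∀ x ∈ C \ A, e x ⊆ C) {x : U} (hx : x ∈ M \ C) :
    IsolatedBy L (e x) (C ∪ {z ∈ M | r z < r x}) ![x] := by
  obtain ⟨m, φ, p, hp, hφ, hφc⟩ := hiso x hx.1
  refine ⟨m, φ, p, hp, hφ, fun c hc =>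
    (sameType_iff_isElementaryRel.2 ?_ : SameType L _ ![x] c).symm⟩
  set P := A ∪ {z ∈ M | r z < r x} with hP
  set D := {y ∈ C \ A | r x < r y} with hD
  have hCPD : C ∪ {z ∈ M | r z < r x} ⊆ P ∪ D := by
    rintro z (hz | hz)
    · by_cases hzA : z ∈ A
      · exact .inl (.inl hzA)
      · rcases lt_trichotomy (r z) (r x) with h | h | h
        · exact .inl (.inr ⟨hCM hz, h⟩)
        · exact absurd (hr (hCM hz) hx.1 h ▸ hz) hx.2
        · exact .inr ⟨⟨hz, hzA⟩, h⟩
    · exact .inl (.inr hz)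
  have hDM : D ⊆ M := fun z hz => hCM hz.1.1
  have main : ∀ F ⊆ P ∪ D, F.Finite →
      IsElementaryRel L (diagOn (P ∪ F) ∪ tupleRel ![x] c) := by
    refine finite_subset_induction (hr.mono hDM) (fun F hF _ => ?_) fun y hy ih F hF hFfin => ?_
    · rw [union_eq_left.2 hF]
      exact sameType_iff_isElementaryRel.1 (hφc c hc).symm
    · have heC : e y ⊆ P ∪ {z ∈ D | r z < r y} := fun z hz => by
        have hzC := hcl y hy.1 hz
        rcases hsub y (hDM hy) hz with hzA | hzM
        · exact .inl (.inl hzA)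
        · rcases hCPD (.inl hzC) with h | h
          exacts [.inl h, .inr ⟨h, hzM.2⟩]
      have hel := ih (F ∪ e y) (union_subset hF heC) (hFfin.union (hfin y))
      obtain ⟨n, ψ, q, hq, hψ⟩ := hiso y (hDM hy)
      have hdom : Prod.fst '' (diagOn (P ∪ (F ∪ e y)) ∪ tupleRel ![x] c) ⊆
          A ∪ {z ∈ M | r z < r y} := by
        have hPy : P ⊆ A ∪ {z ∈ M | r z < r y} :=
          union_subset_union_right _ fun z hz => ⟨hz.1, hz.2.trans hy.2⟩
        have hDy : P ∪ {z ∈ D | r z < r y} ⊆ A ∪ {z ∈ M | r z < r y} :=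
          union_subset hPy fun z hz => .inr ⟨hDM hz.1, hz.2⟩
        rw [image_union, fst_image_diagOn, fst_image_tupleRel]
        refine union_subset (union_subset hPy
          (union_subset (hF.trans hDy) (heC.trans hDy))) ?_
        rintro _ ⟨k, rfl⟩
        simpa using Or.inr ⟨hx.1, hy.2⟩
      refine (hel.union_tupleRel (φ := ψ) (q := fun k => (q k, q k)) (x := ![y]) (y := ![y])
        (fun k => .inl ⟨q k, .inr (.inr (hq k)), rfl⟩)
        ⟨hψ.1, fun d hd => (hψ.2 d hd).mono hdom⟩ hψ.1).mono ?_
      rintro _ (⟨z, hz | rfl | hz, rfl⟩ | hz)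
      · exact .inl (.inl ⟨z, .inl hz, rfl⟩)
      · exact .inr ⟨0, rfl⟩
      · exact .inl (.inl ⟨z, .inr (.inl hz), rfl⟩)
      · exact .inl (.inr hz)
  refine isElementaryRel_of_finite fun G hG hGfin =>
    ⟨_, ?_, main (Prod.fst '' G ∩ (P ∪ D)) inter_subset_right
      ((hGfin.image _).inter_of_left _)⟩
  intro g hg
  rcases hG hg with ⟨z, hz, rfl⟩ | h
  · exact .inl ⟨z, .inr ⟨⟨_, hg, rfl⟩, hCPD hz⟩, rfl⟩
  · exact .inr h

/-- `supp` assigns to each element of `M` a finite set such that `M` is atomic over every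
subset containing `A` and closed under `supp`. -/
structure IsSupport (L : FirstOrder.Language.{u, v}) {U : Type w} [L.Structure U]
    (A M : Set U) (supp : U → Set U) : Prop where
  finite : ∀ x, (supp x).Finite
  subset : ∀ x ∈ M, supp x ⊆ M
  eq_empty : ∀ x ∈ A, supp x = ∅
  isolated : ∀ C, A ⊆ C → C ⊆ M → (∀ x ∈ C, supp x ⊆ C) →
    ∀ (α : Type) [Finite α] (a : α → U), range a ⊆ M → IsolatedType L C a

theorem exists_isSupport {ρ : Type*} [LinearOrder ρ] [WellFoundedLT ρ] {r : U → ρ}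
    {A M : Set U} (hAM : A ⊆ M) (hr : InjOn r M)
    (h : ∀ x ∈ M, IsolatedType L (A ∪ {z ∈ M | r z < r x}) ![x]) :
    ∃ supp, IsSupport L A M supp := by
  classical
  have hex : ∀ x, ∃ e : Set U, e.Finite ∧ (x ∈ M → e ⊆ A ∪ {z ∈ M | r z < r x} ∧
      IsolatedBy L e (A ∪ {z ∈ M | r z < r x}) ![x]) := by
    intro x
    by_cases hx : x ∈ M
    · obtain ⟨e, he, hfin, hiso⟩ := (h x hx).exists_finite
      exact ⟨e, hfin, fun _ => ⟨he, hiso⟩⟩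
    · exact ⟨∅, finite_empty, fun h => absurd h hx⟩
  choose e hfin hM using hex
  have hsub : ∀ x ∈ M, e x ⊆ A ∪ {z ∈ M | r z < r x} := fun x hx => (hM x hx).1
  refine ⟨fun x => if x ∈ A then ∅ else e x, ?_, ?_, ?_, ?_⟩
  · intro x
    split_ifs
    exacts [finite_empty, hfin x]
  · intro x hx
    split_ifs
    exacts [empty_subset _, (hsub x hx).trans (union_subset hAM (sep_subset _ _))]
  · intro x hx
    exact if_pos hx
  · intro C hAC hCM hcl
    replace hcl : ∀ x ∈ C \ A, e x ⊆ C := fun x hx => by simpa [hx.2] using hcl x hx.1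
    have main : ∀ F ⊆ C ∪ M \ C, F.Finite →
        ∀ (α : Type) [Finite α] (a : α → U), range a ⊆ F → IsolatedType L C a := by
      refine finite_subset_induction (hr.mono sdiff_subset)
        (fun F hF _ α _ a ha => isolatedType_of_range_subset (ha.trans hF))
        fun y hy ih F hF hFfin α _ a ha => ?_
      have hC : C ∪ {z ∈ M | r z < r y} = C ∪ {z ∈ M \ C | r z < r y} := by
        ext z
        by_cases hz : z ∈ C <;> simp [hz]
      have hey : e y ⊆ C ∪ {z ∈ M \ C | r z < r y} :=
        hC ▸ (hsub y hy.1).trans (union_subset_union_left _ hAC)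
      obtain ⟨n, c, -, hc⟩ := (hFfin.union (hfin y)).fin_param
      have hcsub : range c ⊆ C ∪ {z ∈ M \ C | r z < r y} := hc ▸ union_subset hF hey
      have hciso := ih _ (union_subset hF hey) (hFfin.union (hfin y)) (Fin n) c hc.le
      have hyiso := isolatedBy_union_of_closed hr hfin hsub (fun x hx => (hM x hx).2)
        hCM hcl hy
      have hyc : IsolatedType L (C ∪ range c) ![y] :=
        hyiso.mono (hc ▸ subset_union_of_subset_right subset_union_right _)
          (hC ▸ union_subset subset_union_left hcsub)
      have hrange : ∀ k, ∃ j, Sum.elim c ![y] j = a k := by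
        intro k
        rcases ha (mem_range_self k) with hk | hk
        · exact ⟨.inr 0, hk.symm⟩
        · obtain ⟨j, hj⟩ : a k ∈ range c := hc ▸ .inl hk
          exact ⟨.inl j, hj⟩
      choose f hf using hrange
      have := (hciso.sumElim hyc).comp f
      rwa [show Sum.elim c ![y] ∘ f = a from funext hf] at this
    intro α _ a ha
    refine main (range a) (ha.trans fun z hz => ?_) (finite_range a) α a le_rfl
    by_cases hzC : z ∈ C
    exacts [.inl hzC, .inr ⟨hz, hzC⟩]

theorem FirstOrder.Language.ElementarySubstructure.exists_realize_mem
    (N : L.ElementarySubstructure U) {α γ : Type} [Finite α] (φ : L.Formula (α ⊕ γ)) {q : γ → U}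
    (hq : ∀ k, q k ∈ N) (h : ∃ z : α → U, φ.Realize (Sum.elim z q)) :
    ∃ z : α → U, (∀ k, z k ∈ N) ∧ φ.Realize (Sum.elim z q) := by
  let χ : L.Formula γ := Formula.iExs α (φ.relabel Sum.swap)
  have hswap : ∀ {X : Type w} (s : γ → X) (z : α → X),
      Sum.elim s z ∘ Sum.swap = Sum.elim z s := fun s z => by ext (k | k) <;> rfl
  let s : γ → N := fun k => ⟨q k, hq k⟩
  have hs : χ.Realize s := by
    rw [← N.subtype.map_formula]
    simp only [χ, Formula.realize_iExs, Formula.realize_relabel, hswap]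
    exact h
  simp only [χ, Formula.realize_iExs, Formula.realize_relabel, hswap] at hs
  obtain ⟨z, hz⟩ := hs
  refine ⟨fun k => z k, fun k => (z k).2, ?_⟩
  rw [← N.subtype.map_formula] at hz
  convert hz using 2
  ext (k | k) <;> rfl

/-- The elementary relations extending the identity of `A` whose domain in `M` and range in `N`
are closed under supports. -/
structure IsClosedRel (L : FirstOrder.Language.{u, v}) {U : Type w} [L.Structure U]
    (A M N : Set U) (supp supp' : U → Set U) (R : Set (U × U)) : Prop where
  elementary : IsElementaryRel L R
  diagOn_subset : diagOn A ⊆ R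
  subset_prod : R ⊆ M ×ˢ N
  fst_closed : ∀ p ∈ R, supp p.1 ⊆ Prod.fst '' R
  snd_closed : ∀ p ∈ R, supp' p.2 ⊆ Prod.snd '' R

section BackAndForth

variable {A M N : Set U} {supp supp' : U → Set U} {R F : Set (U × U)}

theorem IsClosedRel.swap (hR : IsClosedRel L A M N supp supp' R) :
    IsClosedRel L A N M supp' supp (Prod.swap ⁻¹' R) where
  elementary := hR.elementary.swap
  diagOn_subset := by
    rintro _ ⟨x, hx, rfl⟩
    exact hR.diagOn_subset ⟨x, hx, rfl⟩
  subset_prod := fun _ hp => (hR.subset_prod hp).symm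
  fst_closed := fun p hp x hx => by
    obtain ⟨q, hq, rfl⟩ := hR.snd_closed p.swap hp hx
    exact ⟨q.swap, hq, rfl⟩
  snd_closed := fun p hp x hx => by
    obtain ⟨q, hq, rfl⟩ := hR.fst_closed p.swap hp hx
    exact ⟨q.swap, hq, rfl⟩

theorem IsClosedRel.forth {N : L.ElementarySubstructure U} (hM : IsSupport L A M supp)
    (hR : IsClosedRel L A M N supp supp' R) (hF : F.Finite) (hFMN : F ⊆ M ×ˢ (N : Set U))
    (hRF : IsElementaryRel L (R ∪ F)) {x : U} (hx : x ∈ M) :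
    ∃ y ∈ N, IsElementaryRel L (R ∪ insert (x, y) F) := by
  obtain ⟨n, a, -, rfl⟩ := hF.fin_param
  have hdom : Prod.fst '' (R ∪ range a) = Prod.fst '' R ∪ range (Prod.fst ∘ a) := by
    rw [image_union, range_comp]
  have hiso : IsolatedType L (Prod.fst '' (R ∪ range a)) ![x] := by
    rw [hdom]
    refine IsolatedType.of_sumElim (hM.isolated _ ?_ ?_ ?_ _ _ ?_)
    · exact fun z hz => ⟨_, hR.diagOn_subset ⟨z, hz, rfl⟩, rfl⟩
    · rintro _ ⟨p, hp, rfl⟩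
      exact (hR.subset_prod hp).1
    · rintro _ ⟨p, hp, rfl⟩
      exact hR.fst_closed p hp
    · rintro _ ⟨k | k, rfl⟩
      · exact (hFMN (mem_range_self k)).1
      · simpa using hx
  obtain ⟨m, φ, p, hp, hφ⟩ := hiso
  choose q hq hqp using hp
  obtain rfl : Prod.fst ∘ q = p := funext hqp
  have hqN : ∀ k, (q k).2 ∈ N := fun k => by
    rcases hq k with h | h
    exacts [(hR.subset_prod h).2, (hFMN h).2]
  have hex : ∃ z, φ.Realize (Sum.elim z (Prod.snd ∘ q)) := by
    have h := hRF (Fin m) (Formula.iExs (Fin 1) (φ.relabel Sum.swap)) q hq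
    have hswap : ∀ (s : Fin m → U) (z : Fin 1 → U),
        Sum.elim s z ∘ Sum.swap = Sum.elim z s := fun s z => by ext (k | k) <;> rfl
    simp only [Formula.realize_iExs, Formula.realize_relabel, hswap] at h
    exact h.1 ⟨_, hφ.1⟩
  obtain ⟨z, hzN, hz⟩ := N.exists_realize_mem φ hqN hex
  refine ⟨z 0, hzN 0, (hRF.union_tupleRel hq hφ hz).mono ?_⟩
  rintro _ (h | rfl | h)
  · exact .inl (.inl h)
  · exact .inr ⟨0, rfl⟩
  · exact .inl (.inr h)

theorem IsClosedRel.forth_finite {N : L.ElementarySubstructure U} (hM : IsSupport L A M supp)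
    (hR : IsClosedRel L A M N supp supp' R) (hF : F.Finite) (hFMN : F ⊆ M ×ˢ (N : Set U))
    (hRF : IsElementaryRel L (R ∪ F)) {G : Set U} (hG : G.Finite) (hGM : G ⊆ M) :
    ∃ F', F ⊆ F' ∧ F'.Finite ∧ F' ⊆ M ×ˢ (N : Set U) ∧ IsElementaryRel L (R ∪ F') ∧
      G ⊆ Prod.fst '' F' := by
  induction G, hG using Set.Finite.induction_on with
  | empty => exact ⟨F, le_rfl, hF, hFMN, hRF, empty_subset _⟩
  | @insert x G _ _ ih =>
    rw [insert_subset_iff] at hGM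
    obtain ⟨F', hFF', hF', hF'MN, hRF', hGF'⟩ := ih hGM.2
    obtain ⟨y, hy, hxy⟩ := hR.forth hM hF' hF'MN hRF' hGM.1
    refine ⟨insert (x, y) F', hFF'.trans (subset_insert _ _), hF'.insert _,
      insert_subset ⟨hGM.1, hy⟩ hF'MN, hxy, insert_subset ⟨_, mem_insert _ _, rfl⟩
        (hGF'.trans (image_mono (subset_insert _ _)))⟩

theorem IsClosedRel.back_and_forth {M N : L.ElementarySubstructure U}
    (hM : IsSupport L A M supp) (hN : IsSupport L A N supp')
    (hR : IsClosedRel L A M N supp supp' R) (hF : F.Finite)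
    (hFMN : F ⊆ (M : Set U) ×ˢ (N : Set U)) (hRF : IsElementaryRel L (R ∪ F)) {G H : Set U}
    (hG : G.Finite) (hGM : G ⊆ M) (hH : H.Finite) (hHN : H ⊆ N) :
    ∃ F', F ⊆ F' ∧ F'.Finite ∧ F' ⊆ (M : Set U) ×ˢ (N : Set U) ∧ IsElementaryRel L (R ∪ F') ∧
      G ⊆ Prod.fst '' F' ∧ H ⊆ Prod.snd '' F' := by
  obtain ⟨F₁, hFF₁, hF₁, hF₁MN, hRF₁, hGF₁⟩ := hR.forth_finite hM hF hFMN hRF hG hGM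
  obtain ⟨F₂, hF₁F₂, hF₂, hF₂NM, hRF₂, hHF₂⟩ := hR.swap.forth_finite hN
    (hF₁.preimage Prod.swap_injective.injOn) (fun p hp => (hF₁MN hp).symm) hRF₁.swap hH hHN
  refine ⟨Prod.swap ⁻¹' F₂, fun p hp => hF₁F₂ (by simpa using hFF₁ hp),
    hF₂.preimage Prod.swap_injective.injOn, fun p hp => (hF₂NM hp).symm, hRF₂.swap, ?_, ?_⟩
  · intro x hx
    obtain ⟨p, hp, rfl⟩ := hGF₁ hx
    exact ⟨p, hF₁F₂ (by simpa using hp), rfl⟩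
  · intro x hx
    obtain ⟨p, hp, rfl⟩ := hHF₂ hx
    exact ⟨p.swap, by simpa using hp, rfl⟩

theorem IsClosedRel.exists_extension {M N : L.ElementarySubstructure U}
    (hM : IsSupport L A M supp) (hN : IsSupport L A N supp')
    (hR : IsClosedRel L A M N supp supp' R) {G H : Set U}
    (hG : G.Finite) (hGM : G ⊆ M) (hH : H.Finite) (hHN : H ⊆ N) :
    ∃ S, R ⊆ S ∧ IsClosedRel L A M N supp supp' S ∧ G ⊆ Prod.fst '' S ∧ H ⊆ Prod.snd '' S := by
  let T := {F : Set (U × U) // F.Finite ∧ F ⊆ (M : Set U) ×ˢ (N : Set U) ∧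
    IsElementaryRel L (R ∪ F)}
  have hstep : ∀ F : T, ∃ F' : T, F.1 ⊆ F'.1 ∧ (∀ p ∈ F.1, supp p.1 ⊆ Prod.fst '' F'.1) ∧
      ∀ p ∈ F.1, supp' p.2 ⊆ Prod.snd '' F'.1 := by
    rintro ⟨F, hF, hFMN, hRF⟩
    obtain ⟨F', hFF', hF', hF'MN, hRF', hG', hH'⟩ := hR.back_and_forth hM hN hF hFMN hRF
      (hF.biUnion fun p _ => hM.finite p.1)
      (iUnion₂_subset fun p hp => hM.subset p.1 (hFMN hp).1)
      (hF.biUnion fun p _ => hN.finite p.2)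
      (iUnion₂_subset fun p hp => hN.subset p.2 (hFMN hp).2)
    exact ⟨⟨F', hF', hF'MN, hRF'⟩, hFF', iUnion₂_subset_iff.1 hG', iUnion₂_subset_iff.1 hH'⟩
  choose extend hnext hfst hsnd using hstep
  obtain ⟨F₀, -, hF₀, hF₀MN, hRF₀, hG₀, hH₀⟩ := hR.back_and_forth hM hN finite_empty
    (empty_subset _) (by simpa using hR.elementary) hG hGM hH hHN
  let F : ℕ → T := fun n => extend^[n] ⟨F₀, hF₀, hF₀MN, hRF₀⟩
  have hsucc : ∀ n, F (n + 1) = extend (F n) := fun n => Function.iterate_succ_apply' _ _ _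
  have hmono : Monotone fun n => (F n).1 := monotone_nat_of_le_succ fun n => by
    rw [hsucc]
    exact hnext (F n)
  have hsub : ∀ n, (F n).1 ⊆ R ∪ ⋃ n, (F n).1 := fun n =>
    (subset_iUnion (fun n => (F n).1) n).trans subset_union_right
  refine ⟨R ∪ ⋃ n, (F n).1, subset_union_left, ⟨?_, ?_, ?_, ?_, ?_⟩,
    hG₀.trans (image_mono (hsub 0)), hH₀.trans (image_mono (hsub 0))⟩
  · rw [union_iUnion, ← sUnion_range]
    refine isElementaryRel_sUnion (range_nonempty _) ?_ ?_
    · refine directedOn_range.2 (Monotone.directed_le fun m n hmn => ?_)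
      exact union_subset_union_right _ (hmono hmn)
    · rintro _ ⟨n, rfl⟩
      exact (F n).2.2.2
  · exact hR.diagOn_subset.trans subset_union_left
  · exact union_subset hR.subset_prod (iUnion_subset fun n => (F n).2.2.1)
  · rintro p (hp | hp)
    · exact (hR.fst_closed p hp).trans (image_mono subset_union_left)
    · obtain ⟨n, hn⟩ := mem_iUnion.1 hp
      exact (hfst (F n) p hn).trans (image_mono (hsucc n ▸ hsub (n + 1)))
  · rintro p (hp | hp)
    · exact (hR.snd_closed p hp).trans (image_mono subset_union_left)
    · obtain ⟨n, hn⟩ := mem_iUnion.1 hp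
      exact (hsnd (F n) p hn).trans (image_mono (hsucc n ▸ hsub (n + 1)))

theorem isClosedRel_diagOn (hM : IsSupport L A M supp) (hN : IsSupport L A N supp')
    (hAM : A ⊆ M) (hAN : A ⊆ N) : IsClosedRel L A M N supp supp' (diagOn A) where
  elementary := isElementaryRel_diagOn A
  diagOn_subset := le_rfl
  subset_prod := by
    rintro _ ⟨x, hx, rfl⟩
    exact ⟨hAM hx, hAN hx⟩
  fst_closed := by
    rintro _ ⟨x, hx, rfl⟩
    simp [hM.eq_empty x hx]
  snd_closed := by
    rintro _ ⟨x, hx, rfl⟩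
    simp [hN.eq_empty x hx]

theorem isClosedRel_sUnion {c : Set (Set (U × U))} (hne : c.Nonempty)
    (hc : IsChain (· ⊆ ·) c) (h : ∀ R ∈ c, IsClosedRel L A M N supp supp' R) :
    IsClosedRel L A M N supp supp' (⋃₀ c) where
  elementary := isElementaryRel_sUnion hne hc.directedOn fun R hR => (h R hR).elementary
  diagOn_subset :=
    let ⟨R, hR⟩ := hne
    (h R hR).diagOn_subset.trans (subset_sUnion_of_mem hR)
  subset_prod := sUnion_subset fun R hR => (h R hR).subset_prod
  fst_closed := fun p ⟨R, hR, hp⟩ =>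
    ((h R hR).fst_closed p hp).trans (image_mono (subset_sUnion_of_mem hR))
  snd_closed := fun p ⟨R, hR, hp⟩ =>
    ((h R hR).snd_closed p hp).trans (image_mono (subset_sUnion_of_mem hR))

theorem exists_total_isClosedRel {M N : L.ElementarySubstructure U}
    (hM : IsSupport L A M supp) (hN : IsSupport L A N supp') (hAM : A ⊆ M) (hAN : A ⊆ N) :
    ∃ R, IsClosedRel L A M N supp supp' R ∧ Prod.fst '' R = M ∧ Prod.snd '' R = N := by
  obtain ⟨R, -, hR⟩ := zorn_subset_nonempty {R | IsClosedRel L A M N supp supp' R}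
    (fun c hcS hc hne => ⟨_, isClosedRel_sUnion hne hc hcS, fun _ => subset_sUnion_of_mem⟩)
    _ (isClosedRel_diagOn hM hN hAM hAN)
  have hRc : IsClosedRel L A M N supp supp' R := hR.prop
  refine ⟨R, hRc, subset_antisymm (image_subset_iff.2 fun p hp => (hRc.subset_prod hp).1) ?_,
    subset_antisymm (image_subset_iff.2 fun p hp => (hRc.subset_prod hp).2) ?_⟩
  · intro x hx
    obtain ⟨S, hRS, hS, hxS, -⟩ := hRc.exists_extension hM hN (finite_singleton x)
      (singleton_subset_iff.2 hx) finite_empty (empty_subset _)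
    rw [hR.eq_of_subset hS hRS]
    exact hxS rfl
  · intro x hx
    obtain ⟨S, hRS, hS, -, hxS⟩ := hRc.exists_extension hM hN finite_empty (empty_subset _)
      (finite_singleton x) (singleton_subset_iff.2 hx)
    rw [hR.eq_of_subset hS hRS]
    exact hxS rfl

end BackAndForth

/-- A total and surjective elementary relation between elementary substructures is the graph of
an isomorphism. -/
theorem IsElementaryRel.exists_equiv {M N : L.ElementarySubstructure U} {R : Set (U × U)}
    (hR : IsElementaryRel L R) (hfst : Prod.fst '' R = M) (hsnd : Prod.snd '' R = N) :
    ∃ e : M ≃[L] N, ∀ x : M, ((x : U), (e x : U)) ∈ R := by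
  have hf : ∀ x : M, ∃ y : N, ((x : U), (y : U)) ∈ R := fun x => by
    obtain ⟨p, hp, hpx⟩ : (x : U) ∈ Prod.fst '' R := hfst ▸ x.2
    exact ⟨⟨p.2, (hsnd ▸ ⟨p, hp, rfl⟩ : p.2 ∈ (N : Set U))⟩, hpx ▸ hp⟩
  choose f hf using hf
  have hbij : Function.Bijective f := by
    refine ⟨fun x y h => Subtype.ext ((hR.eq_iff (hf x) (hf y)).2 (congrArg _ h)), fun y => ?_⟩
    obtain ⟨p, hp, hpy⟩ : (y : U) ∈ Prod.snd '' R := hsnd ▸ y.2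
    have hpM : p.1 ∈ (M : Set U) := hfst ▸ ⟨p, hp, rfl⟩
    refine ⟨⟨p.1, hpM⟩, Subtype.ext ?_⟩
    rw [← hpy]
    exact (hR.eq_iff (hf ⟨p.1, hpM⟩) hp).1 rfl
  have hform : ∀ {n : ℕ} (φ : L.Formula (Fin n)) (x : Fin n → M),
      φ.Realize (f ∘ x) ↔ φ.Realize x := by
    intro n φ x
    rw [← N.subtype.map_formula, ← M.subtype.map_formula]
    exact (hR (Fin n) φ (fun k => ((x k : U), (f (x k) : U))) fun k => hf (x k)).symm
  refine ⟨{ toEquiv := Equiv.ofBijective f hbij, map_fun' := ?_, map_rel' := ?_ }, hf⟩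
  · intro n F x
    have h := (hform (Formula.graph F) (Fin.cons (Structure.funMap F x) x)).2
      (Formula.realize_graph.2 rfl)
    rw [Fin.comp_cons, Formula.realize_graph] at h
    exact h.symm
  · intro n r x
    have h := hform (r.formula Term.var) x
    rw [Formula.realize_rel, Formula.realize_rel] at h
    exact h

end ElementaryRel

/-- If `M` and `N` are elementary substructures of `U` containing `A`, each
enumerated by a construction sequence over `A` (types computed in `U`), then there is an
isomorphism from `M` onto `N` fixing `A` pointwise. -/
theorem constructible_over_A_isomorphic
    {L : FirstOrder.Language.{u, v}} {U : Type w} [L.Structure U]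
    (A : Set U) (M N : L.ElementarySubstructure U)
    (hAM : A ⊆ (M : Set U)) (hAN : A ⊆ (N : Set U))
    {ι κ : Type*} [LinearOrder ι] [WellFoundedLT ι] [LinearOrder κ] [WellFoundedLT κ]
    {b : ι → U} {c : κ → U}
    (hbran : Set.range b = (M : Set U))
    (hbcon : IsConstructionSequence L A b)
    (hcran : Set.range c = (N : Set U))
    (hccon : IsConstructionSequence L A c) :
    ∃ e : (↥M) ≃[L] (↥N), ∀ (a : U) (ha : a ∈ A), ((e ⟨a, hAM ha⟩ : ↥N) : U) = a := by
  obtain ⟨r, hr, hriso⟩ := hbcon.exists_rank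
  obtain ⟨r', hr', hriso'⟩ := hccon.exists_rank
  rw [hbran] at hr hriso
  rw [hcran] at hr' hriso'
  obtain ⟨supp, hM⟩ := exists_isSupport hAM hr hriso
  obtain ⟨supp', hN⟩ := exists_isSupport hAN hr' hriso'
  obtain ⟨R, hR, hfst, hsnd⟩ := exists_total_isClosedRel hM hN hAM hAN
  obtain ⟨e, he⟩ := hR.elementary.exists_equiv hfst hsnd
  exact ⟨e, fun a ha =>
    ((hR.elementary.eq_iff (hR.diagOn_subset ⟨a, ha, rfl⟩) (he ⟨a, hAM ha⟩)).1 rfl).symm⟩
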